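/- arXiv:2109.01089 — 3 statements merged into one kernel-verified Lean document; each statement's English description precedes it below -/
import Mathlib

section
/- Let a₁, b₁ be reals with 0 < a₁ ≤ b₁, let (a_k, b_k) be the restriction intervals and (c⁽ᵏ⁾) the adaptivity sequence. Let n ≥ 1 and let w⁽ᵏ⁾ : Fin n → ℝ (k ≥ 0) be weight vectors such that every entry of w⁽ᵏ⁾ lies in [a_k, b_k] for all k ≥ 1 and w⁽⁰⁾ = w⁽¹⁾. Then for every k ≥ 1 and every index i, (1/(1 + c⁽ᵏ⁾))·w⁽ᵏ⁻¹⁾ᵢ ≤ w⁽ᵏ⁾ᵢ ≤ (1 + c⁽ᵏ⁾)·w⁽ᵏ⁻¹⁾ᵢ. -/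
/-- Upper endpoint of the restriction interval at step `k`:
`b_k = a₁ * ((1/k²)·(b₁/a₁) + 1 − 1/k²)`. -/
noncomputable def bEnd (a₁ b₁ : ℝ) (k : ℕ) : ℝ :=
  a₁ * ((1 / (k : ℝ) ^ 2) * (b₁ / a₁) + 1 - 1 / (k : ℝ) ^ 2)

/-- Adaptivity sequence: `c⁽¹⁾ = b₁/a₁ − 1` and `c⁽ᵏ⁾ = b_{k−1}/a₁ − 1` for `k > 1`. -/
noncomputable def cSeq (a₁ b₁ : ℝ) (k : ℕ) : ℝ :=
  if k = 1 then b₁ / a₁ - 1 else bEnd a₁ b₁ (k - 1) / a₁ - 1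

theorem bEnd_eq {a₁ : ℝ} (ha : a₁ ≠ 0) (b₁ : ℝ) (k : ℕ) :
    bEnd a₁ b₁ k = a₁ + (b₁ - a₁) / (k : ℝ) ^ 2 := by
  unfold bEnd
  linear_combination (1 / (k : ℝ) ^ 2) * mul_div_cancel₀ b₁ ha

theorem bEnd_le_bEnd {a₁ b₁ : ℝ} (ha : 0 < a₁) (hab : a₁ ≤ b₁) {j k : ℕ} (hj : 1 ≤ j)
    (hjk : j ≤ k) : bEnd a₁ b₁ k ≤ bEnd a₁ b₁ j := by
  rw [bEnd_eq ha.ne', bEnd_eq ha.ne']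
  have hj' : (0 : ℝ) < j := by exact_mod_cast hj
  have hba : 0 ≤ b₁ - a₁ := sub_nonneg.2 hab
  gcongr

theorem one_add_cSeq {a₁ : ℝ} (ha : a₁ ≠ 0) (b₁ : ℝ) (k : ℕ) :
    1 + cSeq a₁ b₁ k = bEnd a₁ b₁ (if k = 1 then 1 else k - 1) / a₁ := by
  unfold cSeq
  split_ifs <;> simp [bEnd_eq ha]

theorem one_div_mul_le_and_le_mul {a B x y : ℝ} (ha : 0 < a) (hx : x ∈ Set.Icc a B)
    (hy : y ∈ Set.Icc a B) : 1 / (B / a) * x ≤ y ∧ y ≤ B / a * x := by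
  have hB : 0 < B := ha.trans_le (hx.1.trans hx.2)
  constructor
  · rw [one_div_div, div_mul_eq_mul_div, div_le_iff₀ hB]
    exact mul_le_mul hy.1 hx.2 (ha.le.trans hx.1) (ha.le.trans hy.1)
  · rw [div_mul_eq_mul_div, le_div_iff₀ ha]
    exact mul_le_mul hy.2 hx.1 ha.le hB.le

/-- entrywise two-sided comparison of consecutive weight vectors. -/
theorem stmt1 (a₁ b₁ : ℝ) (ha : 0 < a₁) (hab : a₁ ≤ b₁)
    (n : ℕ) (hn : 1 ≤ n) (w : ℕ → Fin n → ℝ)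
    (hw : ∀ k : ℕ, 1 ≤ k → ∀ i, w k i ∈ Set.Icc a₁ (bEnd a₁ b₁ k))
    (hw0 : w 0 = w 1) :
    ∀ k : ℕ, 1 ≤ k → ∀ i,
      (1 / (1 + cSeq a₁ b₁ k)) * w (k - 1) i ≤ w k i ∧
      w k i ≤ (1 + cSeq a₁ b₁ k) * w (k - 1) i := by
  intro k hk i
  rw [one_add_cSeq ha.ne']
  apply one_div_mul_le_and_le_mul ha
  · split_ifs with h
    · subst h
      simpa [hw0] using hw 1 le_rfl i
    · exact hw (k - 1) (by omega) i
  · have h := hw k hk i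
    exact ⟨h.1, h.2.trans (bEnd_le_bEnd ha hab (by split_ifs <;> omega) (by split_ifs <;> omega))⟩
end

section
/- Let a₁, b₁ be reals with 0 < a₁ ≤ b₁, let (a_k, b_k) be the restriction intervals and (c⁽ᵏ⁾) the adaptivity sequence. Let n ≥ 1 and let w⁽ᵏ⁾ : Fin n → ℝ (k ≥ 0) be weight vectors such that every entry of w⁽ᵏ⁾ lies in [a_k, b_k] for all k ≥ 1 and w⁽⁰⁾ = w⁽¹⁾. Set W⁽ᵏ⁾ = diagonal(w⁽ᵏ⁾) (an n × n real diagonal matrix). Then for every k ≥ 1, the matrices (1 + c⁽ᵏ⁾)·W⁽ᵏ⁻¹⁾ − W⁽ᵏ⁾ and (1 + c⁽ᵏ⁾)·(W⁽ᵏ⁻¹⁾)⁻¹ − (W⁽ᵏ⁾)⁻¹ are positive semidefinite, i.e., W⁽ᵏ⁾ ⪯ (1 + c⁽ᵏ⁾)·W⁽ᵏ⁻¹⁾ and (W⁽ᵏ⁾)⁻¹ ⪯ (1 + c⁽ᵏ⁾)·(W⁽ᵏ⁻¹⁾)⁻¹ in the Loewner order (the inverses exist since all diagonal entries are strictly positive).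 -/
theorem bEnd_one {a₁ : ℝ} (ha : a₁ ≠ 0) (b₁ : ℝ) : bEnd a₁ b₁ 1 = b₁ := by
  simp [bEnd, mul_div_cancel₀ _ ha]

/-- Diagonal matrices with entries in `[a, B]` are within a factor `B / a` of each other in the
Loewner order, and so are their inverses. -/
theorem posSemidef_smul_diagonal_sub {ι : Type*} [Fintype ι] [DecidableEq ι] {a B : ℝ}
    (ha : 0 < a) {u v : ι → ℝ} (hu : ∀ i, u i ∈ Set.Icc a B) (hv : ∀ i, v i ∈ Set.Icc a B) :
    ((B / a) • Matrix.diagonal u - Matrix.diagonal v).PosSemidef ∧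
      ((B / a) • (Matrix.diagonal u)⁻¹ - (Matrix.diagonal v)⁻¹).PosSemidef := by
  have inv_diagonal {x : ι → ℝ} (hx : ∀ i, x i ∈ Set.Icc a B) :
      (Matrix.diagonal x)⁻¹ = Matrix.diagonal fun i => (x i)⁻¹ := by
    refine Matrix.inv_eq_right_inv ?_
    rw [Matrix.diagonal_mul_diagonal, ← Matrix.diagonal_one]
    congr 1
    ext i
    exact mul_inv_cancel₀ (ha.trans_le (hx i).1).ne'
  rw [inv_diagonal hu, inv_diagonal hv]
  simp only [← Matrix.diagonal_smul, Matrix.diagonal_sub, Matrix.posSemidef_diagonal_iff,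
    Pi.smul_apply, smul_eq_mul, sub_nonneg]
  refine ⟨fun i => ?_, fun i => ?_⟩
  all_goals
    have hui : 0 < u i := ha.trans_le (hu i).1
    have hB : 0 < B := hui.trans_le (hu i).2
  · calc v i ≤ B := (hv i).2
      _ = B / a * a := (div_mul_cancel₀ B ha.ne').symm
      _ ≤ B / a * u i := by gcongr; exact (hu i).1
  · calc (v i)⁻¹ ≤ a⁻¹ := by gcongr; exact (hv i).1
      _ = B / a * B⁻¹ := by field_simp
      _ ≤ B / a * (u i)⁻¹ := by gcongr; exact (hu i).2

/-- Loewner comparison of consecutive diagonal weight matrices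
`W⁽ᵏ⁾ ⪯ (1+c⁽ᵏ⁾)·W⁽ᵏ⁻¹⁾` and `(W⁽ᵏ⁾)⁻¹ ⪯ (1+c⁽ᵏ⁾)·(W⁽ᵏ⁻¹⁾)⁻¹`. -/
theorem stmt2 (a₁ b₁ : ℝ) (ha : 0 < a₁) (hab : a₁ ≤ b₁)
    (n : ℕ) (hn : 1 ≤ n) (w : ℕ → Fin n → ℝ)
    (hw : ∀ k : ℕ, 1 ≤ k → ∀ i, w k i ∈ Set.Icc a₁ (bEnd a₁ b₁ k))
    (hw0 : w 0 = w 1) :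
    ∀ k : ℕ, 1 ≤ k →
      ((1 + cSeq a₁ b₁ k) • Matrix.diagonal (w (k - 1)) -
        Matrix.diagonal (w k)).PosSemidef ∧
      ((1 + cSeq a₁ b₁ k) • (Matrix.diagonal (w (k - 1)))⁻¹ -
        (Matrix.diagonal (w k))⁻¹).PosSemidef := by
  intro k hk
  by_cases hk1 : k = 1
  · subst hk1
    have hc : 1 + cSeq a₁ b₁ 1 = bEnd a₁ b₁ 1 / a₁ := by
      simp [cSeq, bEnd_one ha.ne']
    rw [hc, Nat.sub_self, hw0]
    exact posSemidef_smul_diagonal_sub ha (hw 1 le_rfl) (hw 1 le_rfl)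
  · have hc : 1 + cSeq a₁ b₁ k = bEnd a₁ b₁ (k - 1) / a₁ := by
      simp [cSeq, hk1]
    have hpred : 1 ≤ k - 1 := by omega
    rw [hc]
    exact posSemidef_smul_diagonal_sub ha (hw _ hpred) fun i =>
      ⟨(hw k hk i).1, (hw k hk i).2.trans (bEnd_le_bEnd ha hab hpred (Nat.sub_le k 1))⟩
end

section
/- Let a₁, b₁ be reals with 0 < a₁ ≤ b₁ and let (c⁽ᵏ⁾) be the adaptivity sequence. Then the infinite product ∏_{k=1}^∞ (1 + c⁽ᵏ⁾) converges to a finite limit P with P ≥ 1 (each partial product is bounded above uniformly in k); consequently the constant C = (∑_{k=1}^∞ c⁽ᵏ⁾)·(∏_{k=1}^∞ (1 + c⁽ᵏ⁾)) is finite. -/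
theorem cSeq_one (a₁ b₁ : ℝ) : cSeq a₁ b₁ 1 = b₁ / a₁ - 1 := by
  simp [cSeq]

theorem cSeq_add_two {a₁ : ℝ} (ha : a₁ ≠ 0) (b₁ : ℝ) (k : ℕ) :
    cSeq a₁ b₁ (k + 2) = (b₁ / a₁ - 1) * (1 / ((k + 1 : ℕ) : ℝ) ^ 2) := by
  have hk : k + 2 - 1 = k + 1 := rfl
  rw [cSeq, if_neg (by lia), hk, bEnd, mul_div_cancel_left₀ _ ha]
  ring

theorem cSeq_succ_nonneg {a₁ b₁ : ℝ} (ha : 0 < a₁) (hab : a₁ ≤ b₁) (k : ℕ) :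
    0 ≤ cSeq a₁ b₁ (k + 1) := by
  have h : 0 ≤ b₁ / a₁ - 1 := sub_nonneg.2 ((one_le_div ha).2 hab)
  cases k with
  | zero => rwa [zero_add, cSeq_one]
  | succ k =>
    rw [cSeq_add_two ha.ne']
    positivity

theorem summable_cSeq_succ {a₁ : ℝ} (ha : a₁ ≠ 0) (b₁ : ℝ) :
    Summable fun k : ℕ => cSeq a₁ b₁ (k + 1) := by
  refine (summable_nat_add_iff 1).1 ?_
  simp only [add_assoc, Nat.reduceAdd, cSeq_add_two ha]
  exact ((summable_nat_add_iff 1).2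
    (Real.summable_one_div_nat_pow.2 one_lt_two)).mul_left (b₁ / a₁ - 1)

theorem monotone_prod_range_one_add {f : ℕ → ℝ} (hf : ∀ k, 0 ≤ f k) :
    Monotone fun m : ℕ => ∏ k ∈ Finset.range m, (1 + f k) := by
  refine monotone_nat_of_le_succ fun m => ?_
  rw [Finset.prod_range_succ]
  exact le_mul_of_one_le_right
    (Finset.prod_nonneg fun k _ => add_nonneg zero_le_one (hf k))
    (le_add_of_nonneg_right (hf m))

/-- the infinite product `∏ (1 + c⁽ᵏ⁾)` converges to a finite limit
`P ≥ 1`, the partial products are uniformly bounded by `P`, and the series `∑ c⁽ᵏ⁾`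
converges (so the constant `C = (∑ c⁽ᵏ⁾)·(∏ (1 + c⁽ᵏ⁾))` is finite). -/
theorem stmt6 (a₁ b₁ : ℝ) (ha : 0 < a₁) (hab : a₁ ≤ b₁) :
    ∃ P S : ℝ, 1 ≤ P ∧
      Filter.Tendsto (fun m : ℕ => ∏ k ∈ Finset.range m, (1 + cSeq a₁ b₁ (k + 1)))
        Filter.atTop (nhds P) ∧
      (∀ m : ℕ, ∏ k ∈ Finset.range m, (1 + cSeq a₁ b₁ (k + 1)) ≤ P) ∧
      HasSum (fun k : ℕ => cSeq a₁ b₁ (k + 1)) S := by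
  have hsum := summable_cSeq_succ ha.ne' b₁
  have hlim := (Real.multipliable_one_add_of_summable hsum).hasProd.tendsto_prod_nat
  have hle := (monotone_prod_range_one_add (cSeq_succ_nonneg ha hab)).ge_of_tendsto hlim
  exact ⟨_, _, by simpa using hle 0, hlim, hle, hsum.hasSum⟩
end
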